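/- Let m ≥ 2, M ≥ 1, 0 < δ ≤ 1, l > 0, and let x_1, ..., x_m ∈ ℝ satisfy |x_j| ≤ M for all j and x_j − x_i ≥ δ for all i < j. Let H = V(x) be the Vandermonde matrix of x, and let L be any m×m real (or complex) matrix all of whose entries are bounded in absolute value by l. Then there exists a constant C depending only on m and M (and not on δ, l, or L) such that every entry of H^{-1} L H is bounded in absolute value by C l δ^{1−m}. -/

import Mathlib

/-- The Vandermonde matrix of `x = (x_1, ..., x_m)`, with entries
`V(x)_{ij} = x_j^(i-1)` (indices `0`-based: entry `(i,j)` is `x_j ^ i`). -/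
noncomputable def vanT {m : ℕ} (x : Fin m → ℝ) : Matrix (Fin m) (Fin m) ℝ :=
  (Matrix.vandermonde x).transpose

open Polynomial in
theorem abs_coeff_prod_linear_le {ι : Type*} (s : Finset ι) (a b : ι → ℝ) {A M : ℝ}
    (ha : ∀ i ∈ s, |a i| ≤ A) (hb : ∀ i ∈ s, |b i| ≤ M) (k : ℕ) :
    |(∏ i ∈ s, (C (a i) * (X - C (b i)))).coeff k| ≤ (A * (1 + M)) ^ s.card := by
  classical
  induction s using Finset.induction_on generalizing k with
  | empty =>
    rw [Finset.prod_empty, coeff_one]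
    split_ifs <;> simp
  | insert i s his ih =>
    have hA := ha i (Finset.mem_insert_self i s)
    have hM := hb i (Finset.mem_insert_self i s)
    have ih := ih (fun j hj ↦ ha j (Finset.mem_insert_of_mem hj))
      (fun j hj ↦ hb j (Finset.mem_insert_of_mem hj))
    rw [Finset.prod_insert his, Finset.card_insert_of_notMem his, pow_succ', mul_assoc,
      coeff_C_mul, sub_mul, coeff_sub, coeff_C_mul, abs_mul]
    generalize (∏ i ∈ s, (C (a i) * (X - C (b i)))) = p at ih ⊢
    have hB : 0 ≤ (A * (1 + M)) ^ s.card := (abs_nonneg _).trans (ih 0)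
    have hX : |(X * p).coeff k| ≤ (A * (1 + M)) ^ s.card := by
      cases k with
      | zero => simpa using hB
      | succ k => simpa using ih k
    have hC : |b i * p.coeff k| ≤ M * (A * (1 + M)) ^ s.card := by
      rw [abs_mul]
      exact mul_le_mul hM (ih k) (abs_nonneg _) ((abs_nonneg _).trans hM)
    calc |a i| * |(X * p).coeff k - b i * p.coeff k|
        ≤ A * ((A * (1 + M)) ^ s.card + M * (A * (1 + M)) ^ s.card) :=
          mul_le_mul hA ((abs_sub _ _).trans (add_le_add hX hC)) (abs_nonneg _)
            ((abs_nonneg _).trans hA)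
      _ = A * (1 + M) * (A * (1 + M)) ^ s.card := by ring

theorem vanT_inv_apply {m : ℕ} {x : Fin m → ℝ} (hx : Function.Injective x) (i k : Fin m) :
    (vanT x)⁻¹ i k = (Lagrange.basis Finset.univ x i).coeff k := by
  suffices h : (Matrix.of fun i k : Fin m ↦ (Lagrange.basis Finset.univ x i).coeff k) * vanT x
      = 1 by
    rw [Matrix.inv_eq_left_inv h, Matrix.of_apply]
  ext i j
  have hdeg : (Lagrange.basis Finset.univ x i).natDegree < m := by
    rw [Lagrange.natDegree_basis hx.injOn (Finset.mem_univ i), Finset.card_univ, Fintype.card_fin]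
    exact Nat.sub_lt i.pos one_pos
  have heval : ((Matrix.of fun i k : Fin m ↦ (Lagrange.basis Finset.univ x i).coeff k) * vanT x)
      i j = (Lagrange.basis Finset.univ x i).eval (x j) := by
    rw [Polynomial.eval_eq_sum_range' hdeg, ← Fin.sum_univ_eq_sum_range
      (fun k ↦ (Lagrange.basis Finset.univ x i).coeff k * x j ^ k)]
    rfl
  rw [heval]
  rcases eq_or_ne i j with rfl | hij
  · rw [Lagrange.eval_basis_self hx.injOn (Finset.mem_univ i), Matrix.one_apply_eq]
  · rw [Lagrange.eval_basis_of_ne hij (Finset.mem_univ j), Matrix.one_apply_ne hij]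

theorem abs_vanT_inv_apply_le {m : ℕ} {x : Fin m → ℝ} {M δ : ℝ} (hδ : 0 < δ)
    (hM : ∀ j, |x j| ≤ M) (hx : ∀ i j : Fin m, i < j → δ ≤ x j - x i) (i k : Fin m) :
    |(vanT x)⁻¹ i k| ≤ (δ⁻¹ * (1 + M)) ^ (m - 1) := by
  have hmono : StrictMono x := fun i j hij ↦ by linarith [hx i j hij]
  have hsep : ∀ j, j ≠ i → |(x i - x j)⁻¹| ≤ δ⁻¹ := fun j hj ↦ by
    rw [abs_inv]
    refine inv_anti₀ hδ ?_
    rcases lt_or_gt_of_ne hj with h | h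
    · exact (hx j i h).trans (le_abs_self _)
    · rw [abs_sub_comm]
      exact (hx i j h).trans (le_abs_self _)
  have h := abs_coeff_prod_linear_le (Finset.univ.erase i) (fun j ↦ (x i - x j)⁻¹) x
    (fun j hj ↦ hsep j (Finset.ne_of_mem_erase hj)) (fun j _ ↦ hM j) k
  rw [Finset.card_erase_of_mem (Finset.mem_univ i), Finset.card_univ, Fintype.card_fin] at h
  rw [vanT_inv_apply hmono.injective]
  exact h

theorem abs_mul_mul_apply_le {n : Type*} [Fintype n] (A B D : Matrix n n ℝ) {a b d : ℝ}
    (hA : ∀ i j, |A i j| ≤ a) (hB : ∀ i j, |B i j| ≤ b) (hD : ∀ i j, |D i j| ≤ d) (i j : n) :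
    |(A * B * D) i j| ≤ Fintype.card n ^ 2 * (a * b * d) := by
  have ha : 0 ≤ a := (abs_nonneg _).trans (hA i j)
  have hb : 0 ≤ b := (abs_nonneg _).trans (hB i j)
  simp only [Matrix.mul_apply, Finset.sum_mul]
  calc |∑ k, ∑ k', A i k' * B k' k * D k j|
      ≤ ∑ k, ∑ k', |A i k' * B k' k * D k j| :=
        (Finset.abs_sum_le_sum_abs _ _).trans
          (Finset.sum_le_sum fun _ _ ↦ Finset.abs_sum_le_sum_abs _ _)
    _ ≤ ∑ _k : n, ∑ _k' : n, a * b * d := by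
        refine Finset.sum_le_sum fun k _ ↦ Finset.sum_le_sum fun k' _ ↦ ?_
        rw [abs_mul, abs_mul]
        exact mul_le_mul (mul_le_mul (hA _ _) (hB _ _) (abs_nonneg _) ha) (hD _ _)
          (abs_nonneg _) (mul_nonneg ha hb)
    _ = Fintype.card n ^ 2 * (a * b * d) := by
        simp only [Finset.sum_const, Finset.card_univ, nsmul_eq_mul]
        ring

/-- Conjugation by the Vandermonde matrix of `δ`-separated bounded nodes
degrades a bounded matrix by at most a factor `δ^(1-m)`: there is a constant
`C = C(m, M)`, independent of `δ`, `l` and `L`, such that if `|x_j| ≤ M`,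
`x_j - x_i ≥ δ` for `i < j`, and all entries of `L` are bounded by `l`, then
every entry of `H⁻¹ L H` (with `H = V(x)`) is bounded by `C l δ^(1-m)`. -/
theorem vandermonde_conjugation_lower_order (m : ℕ) (hm : 2 ≤ m) (M : ℝ) (hM : 1 ≤ M) :
    ∃ C : ℝ, 0 < C ∧
      ∀ δ l : ℝ, 0 < δ → δ ≤ 1 → 0 < l →
        ∀ x : Fin m → ℝ, (∀ j : Fin m, |x j| ≤ M) →
          (∀ i j : Fin m, i < j → δ ≤ x j - x i) →
          ∀ L : Matrix (Fin m) (Fin m) ℝ, (∀ i j : Fin m, |L i j| ≤ l) →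
            ∀ i j : Fin m,
              |((vanT x)⁻¹ * L * vanT x) i j| ≤ C * l * δ ^ ((1 : ℝ) - m) := by
  refine ⟨m ^ 2 * (1 + M) ^ (m - 1) * M ^ m, by positivity, ?_⟩
  intro δ l hδ _ _ x hxM hx L hL i j
  have hV : ∀ i j, |vanT x i j| ≤ M ^ m := fun i j ↦ by
    change |x j ^ (i : ℕ)| ≤ M ^ m
    rw [abs_pow]
    exact (pow_le_pow_left₀ (abs_nonneg _) (hxM j) _).trans (pow_le_pow_right₀ hM i.is_lt.le)
  have hδm : δ ^ ((1 : ℝ) - m) = δ⁻¹ ^ (m - 1) := by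
    rw [← neg_sub, Real.rpow_neg hδ.le, inv_pow, ← Real.rpow_natCast,
      Nat.cast_sub (by omega), Nat.cast_one]
  refine (abs_mul_mul_apply_le _ _ _ (abs_vanT_inv_apply_le hδ hxM hx) hL hV i j).trans_eq ?_
  rw [hδm, Fintype.card_fin, mul_pow]
  ring
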